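/- arXiv:2306.14111 — 3 statements merged into one kernel-verified Lean document; each statement's English description precedes it below -/
import Mathlib

section
/- There exist a strictly increasing continuous function σ₂ : ℝ → ℝ with σ₂(0) = 1/2 which is different from the logistic function σ₁(x) = 1/(1 + e^{−x}), reward functions r⁽¹⁾, r⁽²⁾ : {1,2,3} → ℝ, and probability distributions μ_a, μ_b on {1,2,3}, such that σ₁(r⁽¹⁾(i) − r⁽¹⁾(j)) = σ₂(r⁽²⁾(i) − r⁽²⁾(j)) for all i, j ∈ {1,2,3}, yet the induced orderings of expected reward are opposite: Σ_i μ_a(i)·r⁽¹⁾(i) < Σ_i μ_b(i)·r⁽¹⁾(i) while Σ_i μ_a(i)·r⁽²⁾(i) > Σ_i μ_b(i)·r⁽²⁾(i). (Hence when the link function σ translating reward differences into comparison probabilities σ(r(i) − r(j)) is unknown, the optimal policy is indeterminate even with perfect knowledge of all pairwise comparison probabilities.) -/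
/-- An odd, strictly increasing, piecewise linear reparametrisation of reward differences: it has
slope `2` for `1 ≤ |x| ≤ 3 / 2` and slope `1` elsewhere. -/
noncomputable def warp (x : ℝ) : ℝ :=
  x + max 0 (min (x - 1) (1 / 2)) + min 0 (max (x + 1) (-1 / 2))

theorem warp_strictMono : StrictMono warp := by
  intro x y h
  have h₁ : max 0 (min (x - 1) (1 / 2)) ≤ max 0 (min (y - 1) (1 / 2)) := by gcongr
  have h₂ : min 0 (max (x + 1) (-1 / 2)) ≤ min 0 (max (y + 1) (-1 / 2)) := by gcongr
  unfold warp
  linarith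

theorem continuous_warp : Continuous warp := by
  unfold warp
  fun_prop

/-- The logistic function. -/
noncomputable def logistic (x : ℝ) : ℝ := 1 / (1 + Real.exp (-x))

theorem logistic_strictMono : StrictMono logistic := by
  intro x y h
  unfold logistic
  gcongr

theorem continuous_logistic : Continuous logistic := by
  unfold logistic
  exact continuous_const.div (by fun_prop) fun x => by positivity


/-- If the link function translating reward differences into comparison
probabilities is unknown, the optimal policy is indeterminate: two different
link functions (the logistic one and another strictly increasing continuous
one) together with corresponding reward functions produce exactly the same
pairwise comparison probabilities, yet order the two candidate distributions
over outcomes oppositely. -/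
theorem stmt2 :
    ∃ (σ₂ : ℝ → ℝ) (r₁ r₂ : Fin 3 → ℝ) (μa μb : Fin 3 → ℝ),
      StrictMono σ₂ ∧ Continuous σ₂ ∧ σ₂ 0 = 1 / 2 ∧
      σ₂ ≠ (fun x => 1 / (1 + Real.exp (-x))) ∧
      (∀ i j : Fin 3, 1 / (1 + Real.exp (-(r₁ i - r₁ j))) = σ₂ (r₂ i - r₂ j)) ∧
      (∀ i, 0 ≤ μa i) ∧ (∑ i, μa i = 1) ∧
      (∀ i, 0 ≤ μb i) ∧ (∑ i, μb i = 1) ∧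
      (∑ i, μa i * r₁ i < ∑ i, μb i * r₁ i) ∧
      (∑ i, μb i * r₂ i < ∑ i, μa i * r₂ i) := by
  refine ⟨logistic ∘ warp, ![0, 1, 3], ![0, 1, 5 / 2], ![0, 1, 0], ![5 / 8, 0, 3 / 8],
    logistic_strictMono.comp warp_strictMono, continuous_logistic.comp continuous_warp,
    ?_, ?_, ?_, ?_, ?_, ?_, ?_, ?_, ?_⟩
  · norm_num [logistic, warp]
  · intro h
    have h' : warp (3 / 2) = 3 / 2 := logistic_strictMono.injective (congrFun h (3 / 2))
    norm_num [warp] at h'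
  · intro i j
    refine congrArg logistic ?_
    fin_cases i <;> fin_cases j <;> norm_num [warp]
  · intro i
    fin_cases i <;> norm_num
  · norm_num [Fin.sum_univ_succ]
  · intro i
    fin_cases i <;> norm_num
  all_goals norm_num [Fin.sum_univ_succ]
end

section
/- Let F be a class of real-valued functions on a set X, let ε₀ > 0, and let d = dim_E(F, ε₀) with d ≥ 1. Suppose there are points x₁, …, x_K ∈ X, real numbers y₁, …, y_K, functions f₁, …, f_K ∈ F, and a function f* ∈ F such that for every k ∈ {1, …, K}: (i) |f_k(x_k) − f*(x_k)| > ε₀; (ii) Σ_{j<k} (f_k(x_j) − y_j)² ≤ ε₀²/4; and (iii) |y_k − f*(x_k)| ≤ ε₀/(4·sqrt(d)). Then K ≤ d. -/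
/-- `xs` is an eluder sequence for the function class `F` at scale `ε`:
for some `ε' ≥ ε`, every `xs i` is `ε'`-independent of its predecessors. -/
def IsEluderSeq {X : Type*} (F : Set (X → ℝ)) (ε : ℝ) {n : ℕ} (xs : Fin n → X) : Prop :=
  ∃ ε', ε ≤ ε' ∧ ∀ i : Fin n, ∃ f ∈ F, ∃ g ∈ F,
    Real.sqrt (∑ j ∈ Finset.Iio i, (f (xs j) - g (xs j)) ^ 2) ≤ ε' ∧
    ε' ≤ |f (xs i) - g (xs i)|

/-- The eluder dimension of `F` at scale `ε`: the length of the longest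
eluder sequence. -/
noncomputable def eluderDim {X : Type*} (F : Set (X → ℝ)) (ε : ℝ) : ℕ∞ :=
  ⨆ n ∈ {n : ℕ | ∃ xs : Fin n → X, IsEluderSeq F ε xs}, (n : ℕ∞)

theorem IsEluderSeq.le_eluderDim {X : Type*} {F : Set (X → ℝ)} {ε : ℝ} {n : ℕ}
    {xs : Fin n → X} (h : IsEluderSeq F ε xs) : (n : ℕ∞) ≤ eluderDim F ε :=
  le_iSup₂_of_le (f := fun (m : ℕ) (_ : m ∈ {m : ℕ | ∃ xs : Fin m → X, IsEluderSeq F ε xs}) =>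
    (m : ℕ∞)) n ⟨xs, h⟩ le_rfl

/-- If `u` is close to `v` in squared `ℓ²` distance and `v` is uniformly close to `w`, with a
tolerance adapted to the number of terms, then `u` is within `ε` of `w` in `ℓ²` distance. -/
theorem sum_sub_sq_le_of_noise {ι : Type*} (s : Finset ι) (u v w : ι → ℝ) {ε : ℝ} {d : ℕ}
    (hd : 1 ≤ d) (hs : s.card ≤ d) (huv : ∑ j ∈ s, (u j - v j) ^ 2 ≤ ε ^ 2 / 4)
    (hvw : ∀ j, |v j - w j| ≤ ε / (4 * Real.sqrt d)) :
    ∑ j ∈ s, (u j - w j) ^ 2 ≤ ε ^ 2 := by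
  have hd0 : (0 : ℝ) < d := by exact_mod_cast hd
  have hnoise (j : ι) : (v j - w j) ^ 2 ≤ ε ^ 2 / (16 * d) := by
    have h := pow_le_pow_left₀ (abs_nonneg _) (hvw j) 2
    rw [sq_abs, div_pow, mul_pow, Real.sq_sqrt hd0.le] at h
    norm_num at h
    exact h
  have hsum : ∑ j ∈ s, (v j - w j) ^ 2 ≤ ε ^ 2 / 16 := by
    calc ∑ j ∈ s, (v j - w j) ^ 2 ≤ s.card • (ε ^ 2 / (16 * d)) :=
          Finset.sum_le_card_nsmul _ _ _ fun j _ => hnoise j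
      _ ≤ d * (ε ^ 2 / (16 * d)) := by
          rw [nsmul_eq_mul]
          gcongr
      _ = ε ^ 2 / 16 := by field_simp
  calc ∑ j ∈ s, (u j - w j) ^ 2
      ≤ ∑ j ∈ s, (2 * (u j - v j) ^ 2 + 2 * (v j - w j) ^ 2) :=
        Finset.sum_le_sum fun j _ => by nlinarith [sq_nonneg ((u j - v j) - (v j - w j))]
    _ = 2 * ∑ j ∈ s, (u j - v j) ^ 2 + 2 * ∑ j ∈ s, (v j - w j) ^ 2 := by
        rw [Finset.sum_add_distrib, Finset.mul_sum, Finset.mul_sum]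
    _ ≤ ε ^ 2 := by nlinarith [sq_nonneg ε]

/-- Deterministic core of the query-complexity bound for the
Preference-to-Reward interface: each queried point witnesses
`ε₀`-independence from its predecessors, so the number of queried points is at
most the eluder dimension. -/
theorem stmt5 {X : Type*} (F : Set (X → ℝ)) (ε₀ : ℝ) (hε₀ : 0 < ε₀)
    (d : ℕ) (hd : eluderDim F ε₀ = (d : ℕ∞)) (hd1 : 1 ≤ d)
    (K : ℕ) (x : Fin K → X) (y : Fin K → ℝ) (f : Fin K → X → ℝ)
    (hf : ∀ k, f k ∈ F) (fstar : X → ℝ) (hfstar : fstar ∈ F)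
    (h1 : ∀ k, ε₀ < |f k (x k) - fstar (x k)|)
    (h2 : ∀ k, ∑ j ∈ Finset.Iio k, (f k (x j) - y j) ^ 2 ≤ ε₀ ^ 2 / 4)
    (h3 : ∀ k, |y k - fstar (x k)| ≤ ε₀ / (4 * Real.sqrt d)) :
    K ≤ d := by
  by_contra! hK
  have hseq : IsEluderSeq F ε₀ fun i : Fin (d + 1) => x (Fin.castLE hK i) := by
    refine ⟨ε₀, le_rfl, fun i => ⟨f (Fin.castLE hK i), hf _, fstar, hfstar, ?_, (h1 _).le⟩⟩
    refine Real.sqrt_le_iff.2 ⟨hε₀.le, ?_⟩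
    refine sum_sub_sq_le_of_noise (Finset.Iio i)
      (fun j => f (Fin.castLE hK i) (x (Fin.castLE hK j)))
      (fun j => y (Fin.castLE hK j)) (fun j => fstar (x (Fin.castLE hK j))) hd1 ?_ ?_ fun j => h3 _
    · rw [Fin.card_Iio]
      exact Nat.le_of_lt_succ i.isLt
    · have h := h2 (Fin.castLE hK i)
      rw [← Fin.map_castLEEmb_Iio i hK, Finset.sum_map] at h
      exact h
  have hle := hseq.le_eluderDim
  rw [hd, Nat.cast_le] at hle
  exact Nat.not_succ_le_self d hle
end

section
/- Let X be a finite nonempty set, M : X × X → [0, 1], and for probability distributions p, q on X define U(p, q) = Σ_{x,y} p(x)·q(y)·M(x, y) and DGap(p, q) = max_{p'} U(p', q) − min_{q'} U(p, q'), where the max and min range over all probability distributions on X. Let K ≥ 1 and let p₁, …, p_K and q₁, …, q_K be probability distributions on X satisfying the two regret bounds Σ_{k=1}^K U(p_k, q_k) ≥ max_p Σ_{k=1}^K U(p, q_k) − R and Σ_{k=1}^K (1 − U(p_k, q_k)) ≥ max_q Σ_{k=1}^K (1 − U(p_k, q)) − R for some R ≥ 0. Then the averaged distributions p̄ = (1/K)·Σ_k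 p_k and q̄ = (1/K)·Σ_k q_k satisfy DGap(p̄, q̄) ≤ 2R/K. -/
/-- The expected winning probability of distribution `p` against `q` under the
preference function `M`. -/
def gameU {X : Type*} [Fintype X] (M : X → X → ℝ) (p q : X → ℝ) : ℝ :=
  ∑ x, ∑ y, p x * q y * M x y

/-- The duality gap of the pair `(p, q)` in the preference game given by `M`:
`max_{p'} U(p', q) − min_{q'} U(p, q')`, the max/min ranging over all
probability distributions on `X`. -/
noncomputable def dGap {X : Type*} [Fintype X] (M : X → X → ℝ) (p q : X → ℝ) : ℝ :=
  sSup ((fun p' => gameU M p' q) '' stdSimplex ℝ X)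
    - sInf ((fun q' => gameU M p q') '' stdSimplex ℝ X)

theorem gameU_sum_div_left {X ι : Type*} [Fintype X] [Fintype ι] (M : X → X → ℝ)
    (p : ι → X → ℝ) (q : X → ℝ) (c : ℝ) :
    gameU M (fun x => (∑ k, p k x) / c) q = (∑ k, gameU M (p k) q) / c := by
  simp only [gameU, Finset.sum_div, Finset.sum_mul]
  simp_rw [Finset.sum_comm (s := (Finset.univ : Finset ι))]
  refine Finset.sum_congr rfl fun y _ => Finset.sum_congr rfl fun x _ =>
    Finset.sum_congr rfl fun k _ => ?_
  ring

theorem gameU_sum_div_right {X ι : Type*} [Fintype X] [Fintype ι] (M : X → X → ℝ)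
    (p : X → ℝ) (q : ι → X → ℝ) (c : ℝ) :
    gameU M p (fun x => (∑ k, q k x) / c) = (∑ k, gameU M p (q k)) / c := by
  simp only [gameU, Finset.sum_div, Finset.mul_sum, Finset.sum_mul]
  simp_rw [Finset.sum_comm (s := (Finset.univ : Finset ι))]
  refine Finset.sum_congr rfl fun x _ => Finset.sum_congr rfl fun y _ =>
    Finset.sum_congr rfl fun k _ => ?_
  ring

theorem continuous_gameU_left {X : Type*} [Fintype X] (M : X → X → ℝ) (q : X → ℝ) :
    Continuous fun p => gameU M p q := by
  unfold gameU
  fun_prop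

theorem continuous_gameU_right {X : Type*} [Fintype X] (M : X → X → ℝ) (p : X → ℝ) :
    Continuous fun q => gameU M p q := by
  unfold gameU
  fun_prop

/-- Two no-regret learners playing the preference game against each other
compute an approximate equilibrium: if both sequences of distributions satisfy
an `R` regret bound, the averaged pair has duality gap at most `2R/K`. -/
theorem stmt6 {X : Type*} [Fintype X] [Nonempty X] (M : X → X → ℝ)
    (hM : ∀ x y, M x y ∈ Set.Icc (0 : ℝ) 1)
    (K : ℕ) (hK : 1 ≤ K)
    (p q : Fin K → X → ℝ)
    (hp : ∀ k, p k ∈ stdSimplex ℝ X) (hq : ∀ k, q k ∈ stdSimplex ℝ X)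
    (R : ℝ) (hR : 0 ≤ R)
    (h1 : sSup ((fun p' => ∑ k, gameU M p' (q k)) '' stdSimplex ℝ X) - R
      ≤ ∑ k, gameU M (p k) (q k))
    (h2 : sSup ((fun q' => ∑ k, (1 - gameU M (p k) q')) '' stdSimplex ℝ X) - R
      ≤ ∑ k, (1 - gameU M (p k) (q k))) :
    dGap M (fun x => (∑ k, p k x) / K) (fun x => (∑ k, q k x) / K) ≤ 2 * R / K := by
  classical
  have hK0 : (0 : ℝ) < K := by exact_mod_cast hK
  have hne : (stdSimplex ℝ X).Nonempty :=
    ⟨_, single_mem_stdSimplex ℝ (Classical.arbitrary X)⟩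
  have hmax : ∀ p' ∈ stdSimplex ℝ X,
      ∑ k, gameU M p' (q k) ≤ ∑ k, gameU M (p k) (q k) + R := fun p' hp' => by
    have hcont : Continuous fun p' => ∑ k, gameU M p' (q k) :=
      continuous_finsetSum _ fun k _ => continuous_gameU_left M (q k)
    have := le_csSup ((isCompact_stdSimplex ℝ X).bddAbove_image hcont.continuousOn)
      (Set.mem_image_of_mem _ hp')
    linarith
  have hmin : ∀ q' ∈ stdSimplex ℝ X,
      ∑ k, gameU M (p k) (q k) - R ≤ ∑ k, gameU M (p k) q' := fun q' hq' => by
    have hcont : Continuous fun q' => ∑ k, (1 - gameU M (p k) q') :=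
      continuous_finsetSum _ fun k _ =>
        continuous_const.sub (continuous_gameU_right M (p k))
    have := le_csSup ((isCompact_stdSimplex ℝ X).bddAbove_image hcont.continuousOn)
      (Set.mem_image_of_mem _ hq')
    simp only [Finset.sum_sub_distrib] at this h2
    linarith
  have hsup : sSup ((fun p' => gameU M p' fun x => (∑ k, q k x) / K) '' stdSimplex ℝ X)
      ≤ (∑ k, gameU M (p k) (q k) + R) / K := by
    refine csSup_le (hne.image _) (Set.forall_mem_image.2 fun p' hp' => ?_)
    rw [gameU_sum_div_right]
    exact div_le_div_of_nonneg_right (hmax p' hp') hK0.le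
  have hinf : (∑ k, gameU M (p k) (q k) - R) / K
      ≤ sInf ((fun q' => gameU M (fun x => (∑ k, p k x) / K) q') '' stdSimplex ℝ X) := by
    refine le_csInf (hne.image _) (Set.forall_mem_image.2 fun q' hq' => ?_)
    rw [gameU_sum_div_left]
    exact div_le_div_of_nonneg_right (hmin q' hq') hK0.le
  calc dGap M (fun x => (∑ k, p k x) / K) (fun x => (∑ k, q k x) / K)
      ≤ (∑ k, gameU M (p k) (q k) + R) / K - (∑ k, gameU M (p k) (q k) - R) / K :=
        sub_le_sub hsup hinf
    _ = 2 * R / K := by ring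
end
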